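/- Let X be an L∞-space. Then for any Banach spaces Y and Z, a bounded linear operator T : X ⊗̂_ε Y → Z is 1-summing if and only if T# maps X into Π₁(Y,Z) and T# : X → Π₁(Y,Z) is 1-summing. -/

import Mathlib

set_option maxHeartbeats 1000000
set_option synthInstance.maxHeartbeats 400000
set_option maxSynthPendingDepth 3

noncomputable section

open scoped BigOperators NNReal ENNReal
open NormedSpace

/-- The scalar field. -/
notation "𝕂" => ℝ

section Summing

variable {E F : Type} [NormedAddCommGroup E] [NormedSpace 𝕂 E]
  [NormedAddCommGroup F] [NormedSpace 𝕂 F]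

/-- The weak ℓ_q norm of a finite family of vectors:
`sup { (Σ_i ‖e*(e_i)‖^q)^(1/q) : e* ∈ E*, ‖e*‖ ≤ 1 }`. -/
def weakNorm (q : ℝ) {n : ℕ} (e : Fin n → E) : ℝ :=
  ⨆ f : {f : StrongDual 𝕂 E // ‖f‖ ≤ 1}, (∑ i, ‖(f : StrongDual 𝕂 E) (e i)‖ ^ q) ^ (1 / q)

/-- `T` satisfies the (p,q)-summing inequality with constant `C`:
`(Σ_i ‖T e_i‖^p)^(1/p) ≤ C · sup { (Σ_i ‖e*(e_i)‖^q)^(1/q) : ‖e*‖ ≤ 1 }`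
for all finite families `e_1, …, e_n`. -/
def SummingWithC (p q C : ℝ) (T : E →L[𝕂] F) : Prop :=
  ∀ (n : ℕ) (e : Fin n → E),
    (∑ i, ‖T (e i)‖ ^ p) ^ (1 / p) ≤ C * weakNorm q e

/-- `T` is (p,q)-summing. -/
def IsPQSumming (p q : ℝ) (T : E →L[𝕂] F) : Prop :=
  ∃ C, 0 ≤ C ∧ SummingWithC p q C T

/-- `T` is p-summing. -/
def IsPSumming (p : ℝ) (T : E →L[𝕂] F) : Prop := IsPQSumming p p T

/-- The p-summing norm `π_p(T)`: the least admissible constant. -/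
def pNorm (p : ℝ) (T : E →L[𝕂] F) : ℝ :=
  sInf {C | 0 ≤ C ∧ SummingWithC p p C T}

end Summing

section Eps

variable {X Y : Type} [NormedAddCommGroup X] [NormedSpace 𝕂 X]
  [NormedAddCommGroup Y] [NormedSpace 𝕂 Y]

/-- The rank-one operator `x* ↦ x*(x) • y`, realizing the elementary tensor `x ⊗ y`
inside the space of operators from `X*` to `Y`. -/
def elemTensor (x : X) (y : Y) : StrongDual 𝕂 X →L[𝕂] Y :=
  (inclusionInDoubleDual 𝕂 X x).smulRight y

/-- The injective tensor product `X ⊗̂_ε Y`, as a submodule of the operators `X* → Y`: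
the closure of the span of the elementary tensors.  (The operator norm of
`x* ↦ Σ_i x*(x_i) • y_i` is exactly the injective tensor norm of `Σ_i x_i ⊗ y_i`.) -/
def epsSub (X Y : Type) [NormedAddCommGroup X] [NormedSpace 𝕂 X]
    [NormedAddCommGroup Y] [NormedSpace 𝕂 Y] : Submodule 𝕂 (StrongDual 𝕂 X →L[𝕂] Y) :=
  (Submodule.span 𝕂 (Set.range fun p : X × Y => elemTensor p.1 p.2)).topologicalClosure

/-- The injective tensor product `X ⊗̂_ε Y` as a normed space. -/
def EpsTensor (X Y : Type) [NormedAddCommGroup X] [NormedSpace 𝕂 X]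
    [NormedAddCommGroup Y] [NormedSpace 𝕂 Y] : Type := ↥(epsSub X Y)

instance : NormedAddCommGroup (EpsTensor X Y) :=
  inferInstanceAs (NormedAddCommGroup ↥(epsSub X Y))

instance : NormedSpace 𝕂 (EpsTensor X Y) :=
  inferInstanceAs (NormedSpace 𝕂 ↥(epsSub X Y))

instance [CompleteSpace Y] : CompleteSpace (EpsTensor X Y) := by
  have h : IsClosed ((epsSub X Y : Submodule 𝕂 (StrongDual 𝕂 X →L[𝕂] Y)) : Set (StrongDual 𝕂 X →L[𝕂] Y)) := by
    unfold epsSub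
    exact Submodule.isClosed_topologicalClosure _
  exact h.completeSpace_coe

/-- The elementary tensor `x ⊗ y` as an element of `X ⊗̂_ε Y`. -/
def tmulEps (x : X) (y : Y) : EpsTensor X Y :=
  show ↥(epsSub X Y) from
    ⟨elemTensor x y,
      Submodule.le_topologicalClosure _ (Submodule.subset_span ⟨(x, y), rfl⟩)⟩

/-- For fixed `x : X`, the bounded linear map `y ↦ x ⊗ y` from `Y` to `X ⊗̂_ε Y`. -/
def tmulLeft (x : X) : Y →L[𝕂] EpsTensor X Y :=
  show Y →L[𝕂] ↥(epsSub X Y) from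
    ContinuousLinearMap.codRestrict
      (ContinuousLinearMap.smulRightL 𝕂 (StrongDual 𝕂 X) Y (inclusionInDoubleDual 𝕂 X x))
      (epsSub X Y)
      (fun y => Submodule.le_topologicalClosure _ (Submodule.subset_span ⟨(x, y), rfl⟩))

variable {Z : Type} [NormedAddCommGroup Z] [NormedSpace 𝕂 Z]

/-- The operator `T# x : Y → Z` induced by `T : X ⊗̂_ε Y → Z`, i.e. `(T# x) y = T (x ⊗ y)`. -/
def sharp (T : EpsTensor X Y →L[𝕂] Z) (x : X) : Y →L[𝕂] Z :=
  T.comp (tmulLeft x)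

end Eps

section Integral

variable {E F : Type} [NormedAddCommGroup E] [NormedSpace 𝕂 E]
  [NormedAddCommGroup F] [NormedSpace 𝕂 F]

/-- `Φ ∈ (E ⊗̂_ε F*)*` extends the bilinear form `(e, f) ↦ f (T e)` associated to `T`. -/
def ExtendsOf (T : E →L[𝕂] F) (Φ : StrongDual 𝕂 (EpsTensor E (StrongDual 𝕂 F))) : Prop :=
  ∀ (e : E) (f : StrongDual 𝕂 F), Φ (tmulEps e f) = f (T e)

/-- `T : E → F` is an integral operator: the bilinear form `(e, f) ↦ f(T e)` extends to a
bounded linear functional on `E ⊗̂_ε F*`. -/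
def IsIntegralOp (T : E →L[𝕂] F) : Prop := ∃ Φ, ExtendsOf T Φ

/-- The integral norm `‖T‖_int` of `T`: the norm of the extending functional
(the extension is unique, since the elementary tensors span a dense subspace). -/
def integralNorm (T : E →L[𝕂] F) : ℝ :=
  sInf {c | ∃ Φ, ExtendsOf T Φ ∧ ‖Φ‖ = c}

end Integral

section IntegralSpace

variable (Y Z : Type) [NormedAddCommGroup Y] [NormedSpace 𝕂 Y]
  [NormedAddCommGroup Z] [NormedSpace 𝕂 Z]

/-- The space `I(Y,Z)` of integral operators from `Y` to `Z` with the integral norm,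
realized isometrically as the subspace of `(Y ⊗̂_ε Z*)*` consisting of those functionals
that extend the bilinear form of a (necessarily unique) operator `T : Y → Z`. -/
def IntegralSub : Submodule 𝕂 (StrongDual 𝕂 (EpsTensor Y (StrongDual 𝕂 Z))) where
  carrier := {Φ | ∃ T : Y →L[𝕂] Z, ExtendsOf T Φ}
  add_mem' := by
    rintro Φ Ψ ⟨T, hT⟩ ⟨S, hS⟩
    exact ⟨T + S, fun e f => by
      simp [ExtendsOf, ContinuousLinearMap.add_apply, map_add, hT e f, hS e f]⟩
  zero_mem' := ⟨0, fun e f => by simp⟩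
  smul_mem' := by
    rintro c Φ ⟨T, hT⟩
    exact ⟨c • T, fun e f => by
      simp [ContinuousLinearMap.smul_apply, map_smul, hT e f]⟩

/-- The space `I(Y,Z)` of integral operators with the integral norm, as a normed space. -/
def IntegralSpace : Type := ↥(IntegralSub Y Z)

instance : NormedAddCommGroup (IntegralSpace Y Z) :=
  inferInstanceAs (NormedAddCommGroup ↥(IntegralSub Y Z))

instance : NormedSpace 𝕂 (IntegralSpace Y Z) :=
  inferInstanceAs (NormedSpace 𝕂 ↥(IntegralSub Y Z))

variable {Y Z}

/-- The functional in `(Y ⊗̂_ε Z*)*` underlying an element of `I(Y,Z)`. -/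
def IntegralSpace.toFunctional (Φ : IntegralSpace Y Z) : StrongDual 𝕂 (EpsTensor Y (StrongDual 𝕂 Z)) :=
  (show ↥(IntegralSub Y Z) from Φ).1

end IntegralSpace

/-- A Banach space `X` is an `L∞`-space: for some `λ > 1`, every finite-dimensional subspace
`B` of `X` is contained in a finite-dimensional subspace `E` of `X` admitting an invertible
bounded linear operator `T : E → ℓ∞^(dim E)` with `‖T‖ · ‖T⁻¹‖ ≤ λ`. -/
def IsLinftySpace (X : Type) [NormedAddCommGroup X] [NormedSpace ℝ X] : Prop :=
  ∃ l : ℝ, 1 < l ∧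
    ∀ B : Submodule ℝ X, FiniteDimensional ℝ B →
      ∃ E : Submodule ℝ X, B ≤ E ∧ FiniteDimensional ℝ E ∧
        ∃ T : E ≃L[ℝ] (Fin (Module.finrank ℝ E) → ℝ),
          ‖(T : E →L[ℝ] (Fin (Module.finrank ℝ E) → ℝ))‖ *
            ‖(T.symm : (Fin (Module.finrank ℝ E) → ℝ) →L[ℝ] E)‖ ≤ l

section Helpers

variable {E F : Type} [NormedAddCommGroup E] [NormedSpace ℝ E]
  [NormedAddCommGroup F] [NormedSpace ℝ F]

lemma weakNorm_one {n : ℕ} (e : Fin n → E) :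
    weakNorm 1 e = ⨆ f : {f : StrongDual ℝ E // ‖f‖ ≤ 1}, ∑ i, ‖(f : StrongDual ℝ E) (e i)‖ := by
  simp [weakNorm]

lemma weakNorm_bdd {n : ℕ} (e : Fin n → E) :
    BddAbove (Set.range fun f : {f : StrongDual ℝ E // ‖f‖ ≤ 1} =>
      ∑ i, ‖(f : StrongDual ℝ E) (e i)‖) := by
  refine ⟨∑ i, ‖e i‖, ?_⟩
  rintro _ ⟨f, rfl⟩
  refine Finset.sum_le_sum fun i _ => ?_
  calc ‖f.1 (e i)‖ ≤ ‖f.1‖ * ‖e i‖ := f.1.le_opNorm _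
    _ ≤ 1 * ‖e i‖ := by gcongr; exact f.2
    _ = ‖e i‖ := one_mul _

lemma le_weakNorm {n : ℕ} (e : Fin n → E) (f : StrongDual ℝ E) (hf : ‖f‖ ≤ 1) :
    ∑ i, ‖f (e i)‖ ≤ weakNorm 1 e := by
  rw [weakNorm_one]
  exact le_ciSup (weakNorm_bdd e) ⟨f, hf⟩

lemma weakNorm_le {n : ℕ} (e : Fin n → E) (M : ℝ)
    (h : ∀ f : StrongDual ℝ E, ‖f‖ ≤ 1 → ∑ i, ‖f (e i)‖ ≤ M) : weakNorm 1 e ≤ M := by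
  rw [weakNorm_one]
  haveI : Nonempty {f : StrongDual ℝ E // ‖f‖ ≤ 1} := ⟨⟨0, by simp⟩⟩
  exact ciSup_le fun f => h f.1 f.2

lemma weakNorm_nonneg' {n : ℕ} (e : Fin n → E) : 0 ≤ weakNorm 1 e := by
  simpa using le_weakNorm e 0 (by simp)

lemma le_norm_mul_weakNorm {n : ℕ} (e : Fin n → E) (f : StrongDual ℝ E) (c : ℝ) (hc : 0 ≤ c)
    (hf : ‖f‖ ≤ c) : ∑ i, ‖f (e i)‖ ≤ c * weakNorm 1 e := by
  rcases hc.eq_or_lt with rfl | hc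
  · have : f = 0 := by simpa using hf
    simp [this]
  · have := le_weakNorm e (c⁻¹ • f) (by
      rw [norm_smul, Real.norm_of_nonneg (by positivity), inv_mul_le_iff₀ hc]; simpa using hf)
    simp only [ContinuousLinearMap.smul_apply, norm_smul, ← Finset.mul_sum] at this
    rwa [Real.norm_of_nonneg (by positivity), inv_mul_le_iff₀ hc] at this

lemma sum_dual_le_of_signs {ι : Type*} [Fintype ι] (e : ι → E) (M : ℝ)
    (h : ∀ θ : ι → ℝ, (∀ i, ‖θ i‖ ≤ 1) → ‖∑ i, θ i • e i‖ ≤ M)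
    (f : StrongDual ℝ E) (hf : ‖f‖ ≤ 1) : ∑ i, ‖f (e i)‖ ≤ M := by
  let θ : ι → ℝ := fun i => if 0 ≤ f (e i) then 1 else -1
  have h1 : ∑ i, ‖f (e i)‖ = f (∑ i, θ i • e i) := by
    rw [map_sum]
    refine Finset.sum_congr rfl fun i _ => ?_
    rw [map_smul, smul_eq_mul, Real.norm_eq_abs]
    by_cases hi : 0 ≤ f (e i)
    · simp [θ, hi, abs_of_nonneg hi]
    · simp [θ, hi, abs_of_neg (not_le.mp hi)]
  rw [h1]
  calc f (∑ i, θ i • e i) ≤ ‖f (∑ i, θ i • e i)‖ := Real.le_norm_self _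
    _ ≤ ‖f‖ * ‖∑ i, θ i • e i‖ := f.le_opNorm _
    _ ≤ 1 * ‖∑ i, θ i • e i‖ := by gcongr
    _ ≤ M := by
      rw [one_mul]; apply h; intro i; by_cases hi : 0 ≤ f (e i) <;> simp [θ, hi]

lemma summing_iff (C : ℝ) (T : E →L[ℝ] F) :
    SummingWithC 1 1 C T ↔ ∀ (n : ℕ) (e : Fin n → E), ∑ i, ‖T (e i)‖ ≤ C * weakNorm 1 e := by
  simp [SummingWithC]

lemma summing_fintype {C : ℝ} (hC : 0 ≤ C) {T : E →L[ℝ] F} (h : SummingWithC 1 1 C T)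
    {ι : Type*} [Fintype ι] (e : ι → E) (M : ℝ)
    (hM : ∀ f : StrongDual ℝ E, ‖f‖ ≤ 1 → ∑ i, ‖f (e i)‖ ≤ M) :
    ∑ i, ‖T (e i)‖ ≤ C * M := by
  rw [summing_iff] at h
  let s := Fintype.equivFin ι
  have h1 := h _ (e ∘ s.symm)
  have h2 : weakNorm 1 (e ∘ s.symm) ≤ M := by
    apply weakNorm_le
    intro f hf
    have := hM f hf
    rwa [← s.symm.sum_comp] at this
  rw [← s.symm.sum_comp]
  exact h1.trans (by gcongr)

lemma pNorm_spec {T : E →L[ℝ] F} (h : IsPSumming 1 T) {n : ℕ} (e : Fin n → E) :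
    ∑ i, ‖T (e i)‖ ≤ pNorm 1 T * weakNorm 1 e := by
  obtain ⟨C, hC, hCs⟩ := h
  rcases (weakNorm_nonneg' e).eq_or_lt with h0 | h0
  · have := (summing_iff C T).1 hCs n e
    rw [← h0] at this ⊢
    simpa using this
  · rw [← div_le_iff₀ h0]
    refine le_csInf ⟨C, hC, hCs⟩ ?_
    rintro D ⟨hD, hDs⟩
    rw [div_le_iff₀ h0]
    exact (summing_iff D T).1 hDs n e

lemma pNorm_nonneg' (T : E →L[ℝ] F) : 0 ≤ pNorm 1 T :=
  Real.sInf_nonneg fun _ h => h.1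

lemma pNorm_le' {T : E →L[ℝ] F} {c : ℝ} (hc : 0 ≤ c) (h : SummingWithC 1 1 c T) :
    pNorm 1 T ≤ c := csInf_le ⟨0, fun _ h => h.1⟩ ⟨hc, h⟩

lemma eq_zero_of_weakNorm {n : ℕ} (e : Fin n → E) (h : weakNorm 1 e = 0) (i : Fin n) :
    e i = 0 := by
  by_contra hne
  obtain ⟨f, hf, hfe⟩ := exists_dual_vector ℝ (e i) (norm_ne_zero_iff.2 hne)
  have h1 := le_weakNorm e f hf.le
  rw [h] at h1
  have h2 := Finset.single_le_sum (f := fun i => ‖f (e i)‖) (fun i _ => norm_nonneg _)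
    (Finset.mem_univ i)
  have h3 : ‖f (e i)‖ ≤ 0 := h2.trans h1
  rw [hfe] at h3
  simp at h3
  exact hne h3

lemma exists_near_pNorm (T : E →L[ℝ] F) (ε : ℝ) (hε : 0 < ε) :
    ∃ (m : ℕ) (y : Fin m → E), weakNorm 1 y ≤ 1 ∧ pNorm 1 T - ε ≤ ∑ j, ‖T (y j)‖ := by
  by_contra! hcon
  set c := pNorm 1 T - ε with hc
  have hcpos : 0 < c := by
    have := hcon 0 (fun _ => 0) (weakNorm_le _ _ (by simp))
    simpa using this
  have : pNorm 1 T ≤ c := by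
    refine pNorm_le' hcpos.le ((summing_iff c T).2 ?_)
    intro n e
    rcases (weakNorm_nonneg' e).eq_or_lt with h0 | h0
    · have := eq_zero_of_weakNorm e h0.symm
      simp [this, ← h0]
    · have h1 := hcon n (fun i => (weakNorm 1 e)⁻¹ • e i) (by
        apply weakNorm_le
        intro f hf
        simp only [map_smul, norm_smul, ← Finset.mul_sum]
        rw [Real.norm_of_nonneg (by positivity), inv_mul_le_iff₀ h0]
        simpa using le_weakNorm e f hf)
      simp only [map_smul, norm_smul, ← Finset.mul_sum] at h1
      rw [Real.norm_of_nonneg (by positivity), inv_mul_lt_iff₀ h0] at h1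
      linarith
  linarith

end Helpers

section Tensor

variable {X Y Z : Type} [NormedAddCommGroup X] [NormedSpace ℝ X]
  [NormedAddCommGroup Y] [NormedSpace ℝ Y] [NormedAddCommGroup Z] [NormedSpace ℝ Z]

/-- The underlying operator of a tensor. -/
def epsVal : EpsTensor X Y →L[ℝ] (StrongDual ℝ X →L[ℝ] Y) := (epsSub X Y).subtypeL

lemma epsVal_norm (u : EpsTensor X Y) : ‖epsVal u‖ = ‖u‖ := rfl

lemma epsVal_inj {u v : EpsTensor X Y} (h : epsVal u = epsVal v) : u = v := Subtype.ext h

lemma epsVal_tmul (x : X) (y : Y) (f : StrongDual ℝ X) : epsVal (tmulLeft x y) f = f x • y := rfl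

lemma sharp_apply' (T : EpsTensor X Y →L[ℝ] Z) (x : X) (y : Y) :
    sharp T x y = T (tmulLeft x y) := rfl

lemma forward_bound {n : ℕ} (v : Fin n → X) (m : Fin n → ℕ) (y : ∀ i, Fin (m i) → Y)
    (hy : ∀ i, weakNorm 1 (y i) ≤ 1) (θ : (Σ i, Fin (m i)) → ℝ) (hθ : ∀ s, ‖θ s‖ ≤ 1) :
    ‖∑ s : (Σ i, Fin (m i)), θ s • (tmulLeft (v s.1) (y s.1 s.2) : EpsTensor X Y)‖
      ≤ weakNorm 1 v := by
  rw [← epsVal_norm]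
  refine ContinuousLinearMap.opNorm_le_of_unit_norm (weakNorm_nonneg' v) ?_
  intro f hf
  refine NormedSpace.norm_le_dual_bound ℝ _ (weakNorm_nonneg' v) ?_
  intro g
  simp only [map_sum, map_smul, ContinuousLinearMap.sum_apply, ContinuousLinearMap.smul_apply,
    epsVal_tmul]
  refine (norm_sum_le _ _).trans ?_
  rw [Fintype.sum_sigma]
  calc ∑ i, ∑ j, ‖θ ⟨i, j⟩ • f (v i) • g (y i j)‖
      ≤ ∑ i, ∑ j, ‖f (v i)‖ * ‖g (y i j)‖ := by
        refine Finset.sum_le_sum fun i _ => Finset.sum_le_sum fun j _ => ?_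
        rw [norm_smul, norm_smul]
        exact mul_le_of_le_one_left (by positivity) (hθ _)
    _ ≤ ∑ i, ‖f (v i)‖ * ‖g‖ := by
        refine Finset.sum_le_sum fun i _ => ?_
        rw [← Finset.mul_sum]
        gcongr
        calc ∑ j, ‖g (y i j)‖ ≤ ‖g‖ * weakNorm 1 (y i) :=
              le_norm_mul_weakNorm _ _ _ (norm_nonneg _) le_rfl
          _ ≤ ‖g‖ * 1 := by gcongr; exact hy i
          _ = ‖g‖ := mul_one _
    _ ≤ weakNorm 1 v * ‖g‖ := by
        rw [← Finset.sum_mul]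
        gcongr
        exact le_weakNorm v f hf.le

lemma forward_dir (T : EpsTensor X Y →L[ℝ] Z) (h : IsPSumming 1 T) :
    (∀ x : X, IsPSumming 1 (sharp T x)) ∧
        ∃ C, 0 ≤ C ∧ ∀ (n : ℕ) (v : Fin n → X),
          ∑ i, pNorm 1 (sharp T (v i)) ≤ C * weakNorm 1 v := by
  obtain ⟨C, hC, hT⟩ := h
  refine ⟨fun x => ⟨C * ‖(tmulLeft x : Y →L[ℝ] EpsTensor X Y)‖, by positivity, ?_⟩, C, hC, ?_⟩
  · rw [summing_iff]
    intro n e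
    have := summing_fintype hC hT (fun i => tmulLeft x (e i))
      (‖(tmulLeft x : Y →L[ℝ] EpsTensor X Y)‖ * weakNorm 1 e) (by
        intro f hf
        refine le_norm_mul_weakNorm e (f.comp (tmulLeft x)) _ (norm_nonneg _) ?_
        refine (ContinuousLinearMap.opNorm_comp_le _ _).trans ?_
        exact mul_le_of_le_one_left (norm_nonneg _) hf)
    simpa [sharp_apply', mul_assoc] using this
  · intro n v
    refine le_of_forall_pos_le_add fun ε hε => ?_
    have hδ : 0 < ε / (n + 1) := by positivity
    choose m y hy hy2 using fun i => exists_near_pNorm (sharp T (v i)) _ hδ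
    have h1 := summing_fintype hC hT
      (fun s : (Σ i, Fin (m i)) => tmulLeft (v s.1) (y s.1 s.2)) (weakNorm 1 v)
      (sum_dual_le_of_signs _ _ (forward_bound v m y hy))
    rw [Fintype.sum_sigma] at h1
    have h2 := Finset.sum_le_sum fun i (_ : i ∈ Finset.univ) => hy2 i
    simp only [Finset.sum_sub_distrib, Finset.sum_const, Finset.card_univ, Fintype.card_fin,
      nsmul_eq_mul, sharp_apply'] at h2
    have h3 : (n : ℝ) * (ε / (n + 1)) ≤ ε := by
      rw [mul_div_assoc', div_le_iff₀ (by positivity)]; nlinarith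
    simp only [] at h1
    linarith

/-- The algebraic tensors whose first legs lie in `B`. -/
def algSpan (Y : Type) [NormedAddCommGroup Y] [NormedSpace ℝ Y] (B : Submodule ℝ X) :
    Submodule ℝ (StrongDual ℝ X →L[ℝ] Y) :=
  Submodule.span ℝ {w | ∃ x ∈ B, ∃ y : Y, w = elemTensor x y}

lemma algSpan_mono {B B' : Submodule ℝ X} (h : B ≤ B') : algSpan Y B ≤ algSpan Y B' := by
  apply Submodule.span_mono
  rintro w ⟨x, hx, y, rfl⟩
  exact ⟨x, h hx, y, rfl⟩

lemma exists_algSpan (w : StrongDual ℝ X →L[ℝ] Y)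
    (hw : w ∈ Submodule.span ℝ (Set.range fun p : X × Y => elemTensor p.1 p.2)) :
    ∃ B : Submodule ℝ X, FiniteDimensional ℝ B ∧ w ∈ algSpan Y B := by
  induction hw using Submodule.span_induction with
  | mem w h =>
    obtain ⟨⟨x, y⟩, rfl⟩ := h
    refine ⟨Submodule.span ℝ {x}, inferInstance, Submodule.subset_span
      ⟨x, Submodule.mem_span_singleton_self x, y, rfl⟩⟩
  | zero => exact ⟨⊥, inferInstance, zero_mem _⟩
  | add a b _ _ ha hb =>
    obtain ⟨A, hA, hA'⟩ := ha
    obtain ⟨B, hB, hB'⟩ := hb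
    exact ⟨A ⊔ B, inferInstance, add_mem (algSpan_mono le_sup_left hA')
      (algSpan_mono le_sup_right hB')⟩
  | smul c a _ ha =>
    obtain ⟨A, hA, hA'⟩ := ha
    exact ⟨A, hA, Submodule.smul_mem _ _ hA'⟩

lemma algSpan_repr {N : ℕ} (B : Submodule ℝ X) (e : Fin N → X) (φ : Fin N → StrongDual ℝ X)
    (h : ∀ x ∈ B, x = ∑ k, φ k x • e k) (w : StrongDual ℝ X →L[ℝ] Y) (hw : w ∈ algSpan Y B)
    (f : StrongDual ℝ X) : w f = ∑ k, f (e k) • w (φ k) := by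
  induction hw using Submodule.span_induction with
  | mem w hw =>
    obtain ⟨x, hx, y, rfl⟩ := hw
    simp only [elemTensor, ContinuousLinearMap.smulRight_apply, dual_def]
    conv_lhs => rw [h x hx]
    simp [Finset.sum_smul, smul_smul, mul_comm]
  | zero => simp
  | add a b _ _ ha hb => simp [ha, hb, Finset.sum_add_distrib]
  | smul c a _ ha => simp [ha, Finset.smul_sum, smul_smul, mul_comm]

lemma backward_alg {l : ℝ}
    (hl : ∀ B : Submodule ℝ X, FiniteDimensional ℝ B →
      ∃ E : Submodule ℝ X, B ≤ E ∧ FiniteDimensional ℝ E ∧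
        ∃ T : E ≃L[ℝ] (Fin (Module.finrank ℝ E) → ℝ),
          ‖(T : E →L[ℝ] (Fin (Module.finrank ℝ E) → ℝ))‖ *
            ‖(T.symm : (Fin (Module.finrank ℝ E) → ℝ) →L[ℝ] E)‖ ≤ l)
    (T : EpsTensor X Y →L[ℝ] Z) (hs : ∀ x : X, IsPSumming 1 (sharp T x)) {C : ℝ} (hC : 0 ≤ C)
    (hT : ∀ (n : ℕ) (v : Fin n → X), ∑ i, pNorm 1 (sharp T (v i)) ≤ C * weakNorm 1 v)
    {n : ℕ} (u : Fin n → EpsTensor X Y)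
    (hu : ∀ i, epsVal (u i) ∈
      Submodule.span ℝ (Set.range fun p : X × Y => elemTensor p.1 p.2)) :
    ∑ i, ‖T (u i)‖ ≤ C * l * weakNorm 1 u := by
  choose B hB hB' using fun i => exists_algSpan _ (hu i)
  obtain ⟨E, hBE, hE, S₀, hS₀⟩ := hl (⨆ i, B i) inferInstance
  obtain ⟨N, S, hS⟩ : ∃ (N : ℕ) (S : E ≃L[ℝ] (Fin N → ℝ)),
      ‖(S : E →L[ℝ] (Fin N → ℝ))‖ * ‖(S.symm : (Fin N → ℝ) →L[ℝ] E)‖ ≤ l := ⟨_, S₀, hS₀⟩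
  set a := ‖(S : E →L[ℝ] (Fin N → ℝ))‖ with ha
  set b := ‖(S.symm : (Fin N → ℝ) →L[ℝ] E)‖ with hb
  let e : Fin N → X := fun k => (S.symm (Pi.single k 1) : E)
  have hφ : ∀ k : Fin N, ∃ φ : StrongDual ℝ X, (∀ x : E, φ x = S x k) ∧ ‖φ‖ ≤ a := by
    intro k
    obtain ⟨φ, h1, h2⟩ := exists_extension_norm_eq E
      ((ContinuousLinearMap.proj k).comp (S : E →L[ℝ] (Fin N → ℝ)))
    refine ⟨φ, h1, ?_⟩
    rw [h2]
    refine ContinuousLinearMap.opNorm_le_bound _ (norm_nonneg _) fun x => ?_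
    exact (norm_le_pi_norm (S x) k).trans ((S : E →L[ℝ] (Fin N → ℝ)).le_opNorm x)
  choose φ hφ1 hφ2 using hφ
  have hrep : ∀ x ∈ E, x = ∑ k, φ k x • e k := by
    intro x hx
    have h1 : S.symm (S ⟨x, hx⟩) = ∑ k, S ⟨x, hx⟩ k • S.symm (Pi.single k 1) := by
      conv_lhs => rw [pi_eq_sum_univ' (S ⟨x, hx⟩)]
      rw [map_sum]
      refine Finset.sum_congr rfl fun k _ => ?_
      rw [map_smul]
    rw [S.symm_apply_apply] at h1
    have h2 := congrArg (Subtype.val) h1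
    simp only [Submodule.coe_sum, Submodule.coe_smul] at h2
    conv_lhs => rw [h2]
    refine Finset.sum_congr rfl fun k _ => ?_
    rw [hφ1 k ⟨x, hx⟩]
  have hwe : weakNorm 1 e ≤ b := by
    refine weakNorm_le _ _ (sum_dual_le_of_signs _ _ fun θ hθ => ?_)
    have h1 : ∑ k, θ k • e k = ((S.symm (∑ k, θ k • Pi.single k 1) : E) : X) := by
      rw [map_sum, Submodule.coe_sum]
      refine Finset.sum_congr rfl fun k _ => ?_
      rw [map_smul]; rfl
    rw [h1]
    calc ‖S.symm (∑ k, θ k • Pi.single k 1)‖ ≤ b * ‖∑ k, θ k • (Pi.single k 1 : Fin N → ℝ)‖ :=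
          (S.symm : (Fin N → ℝ) →L[ℝ] E).le_opNorm _
      _ ≤ b * 1 := by
          gcongr
          rw [pi_norm_le_iff_of_nonneg zero_le_one]
          intro j
          simpa [Finset.sum_apply, Pi.single_apply] using hθ j
      _ = b := mul_one _
  have hui : ∀ i, u i = ∑ k, tmulLeft (e k) (epsVal (u i) (φ k)) := by
    intro i
    apply epsVal_inj
    ext f
    rw [algSpan_repr E e φ hrep _ (algSpan_mono ((le_iSup B i).trans hBE) (hB' i)) f]
    simp [epsVal_tmul]
  have hwy : ∀ k, weakNorm 1 (fun i => epsVal (u i) (φ k)) ≤ a * weakNorm 1 u := by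
    intro k
    refine weakNorm_le _ _ fun g hg => ?_
    refine le_norm_mul_weakNorm u
      (g.comp ((ContinuousLinearMap.apply ℝ Y (φ k)).comp epsVal)) a (norm_nonneg _) ?_
    refine ContinuousLinearMap.opNorm_le_bound _ (norm_nonneg _) fun w => ?_
    calc ‖g (epsVal w (φ k))‖ ≤ ‖g‖ * ‖epsVal w (φ k)‖ := g.le_opNorm _
      _ ≤ 1 * (‖epsVal w‖ * ‖φ k‖) := by
          gcongr
          exact (epsVal w).le_opNorm _
      _ ≤ 1 * (‖w‖ * a) := by
          rw [epsVal_norm]; gcongr; exact hφ2 k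
      _ = a * ‖w‖ := by ring
  have hw0 := weakNorm_nonneg' u
  calc ∑ i, ‖T (u i)‖ ≤ ∑ i, ∑ k, ‖sharp T (e k) (epsVal (u i) (φ k))‖ := by
        refine Finset.sum_le_sum fun i _ => ?_
        conv_lhs => rw [hui i, map_sum]
        exact norm_sum_le _ _
    _ = ∑ k, ∑ i, ‖sharp T (e k) (epsVal (u i) (φ k))‖ := Finset.sum_comm
    _ ≤ ∑ k, pNorm 1 (sharp T (e k)) * (a * weakNorm 1 u) := by
        refine Finset.sum_le_sum fun k _ => (pNorm_spec (hs (e k)) _).trans ?_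
        exact mul_le_mul_of_nonneg_left (hwy k) (pNorm_nonneg' _)
    _ = (∑ k, pNorm 1 (sharp T (e k))) * (a * weakNorm 1 u) := by rw [Finset.sum_mul]
    _ ≤ (C * b) * (a * weakNorm 1 u) := by
        refine mul_le_mul_of_nonneg_right ((hT N e).trans ?_) (by positivity)
        gcongr
    _ = C * (a * b) * weakNorm 1 u := by ring
    _ ≤ C * l * weakNorm 1 u := by gcongr

lemma exists_near_alg (u : EpsTensor X Y) (δ : ℝ) (hδ : 0 < δ) :
    ∃ v : EpsTensor X Y, epsVal v ∈
      Submodule.span ℝ (Set.range fun p : X × Y => elemTensor p.1 p.2) ∧ ‖u - v‖ ≤ δ := by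
  have h : epsVal u ∈ closure ((Submodule.span ℝ
      (Set.range fun p : X × Y => elemTensor p.1 p.2) : Submodule ℝ _) : Set _) := u.2
  obtain ⟨w, hw, hd⟩ := Metric.mem_closure_iff.1 h δ hδ
  refine ⟨⟨w, Submodule.le_topologicalClosure _ hw⟩, hw, ?_⟩
  rw [dist_eq_norm] at hd
  exact hd.le

lemma backward_dir {l : ℝ} (l0 : 0 ≤ l)
    (hl : ∀ B : Submodule ℝ X, FiniteDimensional ℝ B →
      ∃ E : Submodule ℝ X, B ≤ E ∧ FiniteDimensional ℝ E ∧
        ∃ T : E ≃L[ℝ] (Fin (Module.finrank ℝ E) → ℝ),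
          ‖(T : E →L[ℝ] (Fin (Module.finrank ℝ E) → ℝ))‖ *
            ‖(T.symm : (Fin (Module.finrank ℝ E) → ℝ) →L[ℝ] E)‖ ≤ l)
    (T : EpsTensor X Y →L[ℝ] Z) (hs : ∀ x : X, IsPSumming 1 (sharp T x)) {C : ℝ} (hC : 0 ≤ C)
    (hT : ∀ (n : ℕ) (v : Fin n → X), ∑ i, pNorm 1 (sharp T (v i)) ≤ C * weakNorm 1 v) :
    IsPSumming 1 T := by
  refine ⟨C * l, by positivity, (summing_iff _ _).2 fun n u => ?_⟩
  refine le_of_forall_pos_le_add fun ε hε => ?_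
  set K := (n : ℝ) * (C * l + ‖T‖) with hK
  have hK0 : 0 ≤ K := by positivity
  set δ := ε / (K + 1) with hδ
  have hδ0 : 0 < δ := by positivity
  choose v hv hd using fun i => exists_near_alg (u i) δ hδ0
  have h1 := backward_alg hl T hs hC hT v hv
  have h2 : weakNorm 1 v ≤ weakNorm 1 u + n * δ := by
    refine weakNorm_le _ _ fun f hf => ?_
    calc ∑ i, ‖f (v i)‖ ≤ ∑ i, (‖f (u i)‖ + δ) := by
          refine Finset.sum_le_sum fun i _ => ?_
          have e1 : f (v i) = f (u i) - f (u i - v i) := by rw [map_sub]; ring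
          rw [e1]
          refine (norm_sub_le _ _).trans ?_
          gcongr
          refine (f.le_opNorm _).trans ?_
          exact (mul_le_of_le_one_left (norm_nonneg _) hf).trans (hd i)
      _ = ∑ i, ‖f (u i)‖ + n * δ := by simp [Finset.sum_add_distrib]
      _ ≤ _ := by gcongr; exact le_weakNorm u f hf
  have h3 : ∑ i, ‖T (u i)‖ ≤ ∑ i, ‖T (v i)‖ + n * (‖T‖ * δ) := by
    calc ∑ i, ‖T (u i)‖ ≤ ∑ i, (‖T (v i)‖ + ‖T‖ * δ) := by
          refine Finset.sum_le_sum fun i _ => ?_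
          have e1 : T (u i) = T (v i) + T (u i - v i) := by rw [map_sub]; abel
          rw [e1]
          refine (norm_add_le _ _).trans ?_
          gcongr
          refine (T.le_opNorm _).trans ?_
          gcongr
          exact hd i
      _ = _ := by simp [Finset.sum_add_distrib]
  have h4 : C * l * weakNorm 1 v ≤ C * l * (weakNorm 1 u + n * δ) := by gcongr
  have h5 : K * δ ≤ ε := by
    rw [hδ, mul_div_assoc', div_le_iff₀ (by positivity)]; nlinarith
  have h6 : K * δ = C * l * (n * δ) + n * (‖T‖ * δ) := by rw [hK]; ring
  rw [mul_add] at h4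
  linarith

end Tensor

/-- Theorem 5: if `X` is an `L∞`-space, then for any Banach spaces `Y` and `Z` a
bounded linear operator `T : X ⊗̂_ε Y → Z` is 1-summing if and only if `T#` maps `X` into
`Π₁(Y,Z)` and `T# : X → Π₁(Y,Z)` is 1-summing (i.e. every `T# x` is 1-summing and there is
`C ≥ 0` with `Σ_i π₁(T# x_i) ≤ C · sup { Σ_i |x*(x_i)| : ‖x*‖ ≤ 1 }` for all finite
families in `X`). -/
theorem statement8 (X Y Z : Type)
    [NormedAddCommGroup X] [NormedSpace ℝ X] [CompleteSpace X]
    [NormedAddCommGroup Y] [NormedSpace ℝ Y] [CompleteSpace Y]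
    [NormedAddCommGroup Z] [NormedSpace ℝ Z] [CompleteSpace Z]
    (hX : IsLinftySpace X)
    (T : EpsTensor X Y →L[ℝ] Z) :
    IsPSumming 1 T ↔
      ((∀ x : X, IsPSumming 1 (sharp T x)) ∧
        ∃ C, 0 ≤ C ∧ ∀ (n : ℕ) (v : Fin n → X),
          ∑ i, pNorm 1 (sharp T (v i)) ≤ C * weakNorm 1 v) := by
  constructor
  · exact forward_dir T
  · rintro ⟨hs, C, hC, hT⟩
    obtain ⟨l, hl1, hl⟩ := hX
    exact backward_dir (by linarith) hl T hs hC hT
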